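/- Let P ⊆ {0,1}^{2k} be a predicate such that a·b ∈ P and b·a ∈ P (concatenation) for every a in the support of 𝒫₀ and every b in the support of 𝒫₁, and let 𝒢 be the P-CSP instance produced by the long code test 𝒯₂ from a Label-Cover instance G. If G admits a labeling ℓ satisfying all of its edges, then the two assignments f_v(x) := x_{ℓ(v)} and g_v(x) := x_{R+ℓ(v)} satisfy: each of f and g covers at least a 1 − ε fraction of the constraints of 𝒢 (under the test distribution), and for every constraint in the support of 𝒯₂ at least one of f, g covers it; hence {f, g} is a 2-covering of 𝒢. -/

import Mathlib

open Finset

/-! Common setup for the long code test `𝒯₂` of Dinur–Kol / this paper.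

A Label-Cover instance consists of a bipartite graph on `U × V` given by a Boolean
adjacency relation `Adj`, with projections `π u v : Fin R → Fin L`; we assume `R = d·L`
and that all fibers `π_{uv}^{-1}(i)` have size `d`.  Long-code strings in `{0,1}^{2R}`
are indexed by `Fin R ⊕ Fin R` (`Sum.inl j` is position `j ∈ [R]`, `Sum.inr j` is
position `j + R`). -/

/-- Choose `P1` if `b = true`, else `P0`. -/
def pick {k : ℕ} (P0 P1 : (Fin k → Bool) → ℝ) (b : Bool) : (Fin k → Bool) → ℝ :=
  if b = true then P1 else P0

/-- The fiber `π_{uv}^{-1}(i) ⊆ [R]`. -/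
def fib {U V : Type} {L R : ℕ} (π : U → V → Fin R → Fin L) (u : U) (v : V) (i : Fin L) :
    Finset (Fin R) :=
  univ.filter (fun j => π u v j = i)

/-- Mass contributed by block `i ∈ [L]` of the test `𝒯₂` for fixed `u, v, w`:
a uniform bit `c₁` decides whether the `X`-columns of the block (of both halves,
`B_{uv}(i)` and `B'_{uv}(i)`) are i.i.d. `𝒫₀` and the `Y`-columns i.i.d. `𝒫₁`, or vice
versa; then independently with probability `1 − 2ε` nothing is changed, with probability
`ε` the primed halves `(X|_{B'_{uv}(i)}, Y|_{B'_{uw}(i)})` are resampled uniformly, and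
with probability `ε` the unprimed halves are resampled uniformly. -/
noncomputable def blockM {U V : Type} {k L R : ℕ} (π : U → V → Fin R → Fin L)
    (ε : ℝ) (P0 P1 : (Fin k → Bool) → ℝ) (d : ℕ) (u : U) (v w : V) (i : Fin L)
    (X Y : Fin k → (Fin R ⊕ Fin R) → Bool) : ℝ :=
  (1 / 2) * ∑ b : Bool,
    ((1 - 2 * ε) *
        ((∏ j ∈ fib π u v i,
            pick P0 P1 b (fun r => X r (Sum.inl j)) * pick P0 P1 b (fun r => X r (Sum.inr j))) *
         (∏ j ∈ fib π u w i,
            pick P0 P1 (!b) (fun r => Y r (Sum.inl j)) * pick P0 P1 (!b) (fun r => Y r (Sum.inr j))))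
     + ε * ((∏ j ∈ fib π u v i, pick P0 P1 b (fun r => X r (Sum.inl j))) *
            (∏ j ∈ fib π u w i, pick P0 P1 (!b) (fun r => Y r (Sum.inl j)))) *
          ((1 : ℝ) / 2 ^ k) ^ (2 * d)
     + ε * ((∏ j ∈ fib π u v i, pick P0 P1 b (fun r => X r (Sum.inr j))) *
            (∏ j ∈ fib π u w i, pick P0 P1 (!b) (fun r => Y r (Sum.inr j)))) *
          ((1 : ℝ) / 2 ^ k) ^ (2 * d))

/-- Mass of the pair of matrices `(X, Y)` under the test `𝒯₂` for fixed `u, v, w`: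
the blocks `i ∈ [L]` are independent. -/
noncomputable def massT2 {U V : Type} {k L R : ℕ} (π : U → V → Fin R → Fin L)
    (ε : ℝ) (P0 P1 : (Fin k → Bool) → ℝ) (d : ℕ) (u : U) (v w : V)
    (X Y : Fin k → (Fin R ⊕ Fin R) → Bool) : ℝ :=
  ∏ i : Fin L, blockM π ε P0 P1 d u v w i X Y

/-- Expectation over `(X, Y) ∼ 𝒯₂` (for fixed `u, v, w`) of a function of the two
matrices. -/
noncomputable def ET2 {U V : Type} {k L R : ℕ} (π : U → V → Fin R → Fin L)
    (ε : ℝ) (P0 P1 : (Fin k → Bool) → ℝ) (d : ℕ) (u : U) (v w : V)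
    (h : (Fin k → (Fin R ⊕ Fin R) → Bool) → (Fin k → (Fin R ⊕ Fin R) → Bool) → ℝ) : ℝ :=
  ∑ X : Fin k → (Fin R ⊕ Fin R) → Bool, ∑ Y : Fin k → (Fin R ⊕ Fin R) → Bool,
    massT2 π ε P0 P1 d u v w X Y * h X Y

/-- The neighbors of `u ∈ U` in the bipartite graph. -/
def nbr {U V : Type} [Fintype V] (Adj : U → V → Bool) (u : U) : Finset V :=
  univ.filter (fun v => Adj u v = true)

/-- Expectation over a uniform `u ∈ U` and uniform independent neighbors `v, w` of `u`. -/
noncomputable def Euvw {U V : Type} [Fintype U] [Fintype V] (Adj : U → V → Bool)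
    (h : U → V → V → ℝ) : ℝ :=
  (1 / (Fintype.card U : ℝ)) * ∑ u : U, (1 / ((nbr Adj u).card : ℝ) ^ 2) *
    ∑ v ∈ nbr Adj u, ∑ w ∈ nbr Adj u, h u v w

/-- The Fourier character `χ_β` on `{0,1}^{2R}` (bits identified with `±1`). -/
def chi {R : ℕ} (β : Finset (Fin R ⊕ Fin R)) (x : (Fin R ⊕ Fin R) → Bool) : ℝ :=
  ∏ c ∈ β, (if x c = true then (-1 : ℝ) else 1)

/-- The Fourier coefficient `f̂(β)` of `f : {0,1}^{2R} → ℝ` over the uniform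
distribution. -/
noncomputable def fhat {R : ℕ} (f : ((Fin R ⊕ Fin R) → Bool) → ℝ)
    (β : Finset (Fin R ⊕ Fin R)) : ℝ :=
  (∑ x : (Fin R ⊕ Fin R) → Bool, f x * chi β x) / (2 : ℝ) ^ (2 * R)

/-- The noise operator `T_{1-γ} f = Σ_β (1-γ)^{|β|} f̂(β) χ_β`. -/
noncomputable def noiseT {R : ℕ} (γ : ℝ) (f : ((Fin R ⊕ Fin R) → Bool) → ℝ) :
    ((Fin R ⊕ Fin R) → Bool) → ℝ :=
  fun x => ∑ β : Finset (Fin R ⊕ Fin R), (1 - γ) ^ β.card * fhat f β * chi β x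

/-- `π̃_{uv}(β) := {i ∈ [L] : ∃ j ∈ [R], (j ∈ β ∨ j + R ∈ β) ∧ π_{uv}(j) = i}`. -/
def ptil {U V : Type} {L R : ℕ} (π : U → V → Fin R → Fin L) (u : U) (v : V)
    (β : Finset (Fin R ⊕ Fin R)) : Finset (Fin L) :=
  univ.filter (fun i => ∃ j : Fin R, (Sum.inl j ∈ β ∨ Sum.inr j ∈ β) ∧ π u v j = i)

/-- The grouped influence `Inf̄ᵘ_i[f] = Σ_{α : i ∈ π̃_{uv}(α)} f̂(α)²`. -/
noncomputable def gInf {U V : Type} {L R : ℕ} (π : U → V → Fin R → Fin L) (u : U) (v : V)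
    (f : ((Fin R ⊕ Fin R) → Bool) → ℝ) (i : Fin L) : ℝ :=
  ∑ β ∈ univ.filter (fun β : Finset (Fin R ⊕ Fin R) => i ∈ ptil π u v β), (fhat f β) ^ 2

/-- A product over all fibers of `r`, with a parameter `t` depending on the fiber. -/
theorem prod_prod_fiber {I S γ : Type*} [Fintype I] [DecidableEq I] [Fintype γ]
    (r : γ → I) (H : S → γ → ℝ) (t : I → S) :
    ∏ i, ∏ a with r a = i, H (t i) a = ∏ a, H (t (r a)) a := by
  rw [← Finset.prod_fiberwise univ r]
  refine Finset.prod_congr rfl fun i _ => Finset.prod_congr rfl fun a ha => ?_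
  rw [(Finset.mem_filter.1 ha).2]

/-- If block-wise factors are mixtures (with weights `c i`) of products of probability
masses over the coordinates in the block, then the total mass is the product of the total
weights. -/
theorem sum_prod_mixture {I S α β K : Type*} [Fintype I] [DecidableEq I] [Fintype S]
    [Fintype α] [DecidableEq α] [Fintype β] [DecidableEq β] [Fintype K]
    (p : α → I) (q : β → I) (F : S → α → K → ℝ) (G : S → β → K → ℝ)
    (hF : ∀ s a, ∑ x, F s a x = 1) (hG : ∀ s b, ∑ x, G s b x = 1) (c : I → S → ℝ) :
    ∑ X : α → K, ∑ Y : β → K, ∏ i, ∑ s, c i s *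
        ((∏ a with p a = i, F s a (X a)) * ∏ b with q b = i, G s b (Y b)) =
      ∏ i, ∑ s, c i s := by
  have expand : ∀ (X : α → K) (Y : β → K), ∏ i, ∑ s, c i s *
        ((∏ a with p a = i, F s a (X a)) * ∏ b with q b = i, G s b (Y b)) =
      ∑ t : I → S, (∏ i, c i (t i)) *
        ((∏ a, F (t (p a)) a (X a)) * ∏ b, G (t (q b)) b (Y b)) := by
    intro X Y
    rw [Fintype.prod_sum]
    refine Finset.sum_congr rfl fun t _ => ?_
    rw [Finset.prod_mul_distrib, Finset.prod_mul_distrib,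
      prod_prod_fiber p (fun s a => F s a (X a)),
      prod_prod_fiber q (fun s b => G s b (Y b))]
  have marginal : ∀ t : I → S, (∑ X : α → K, ∏ a, F (t (p a)) a (X a)) *
      ∑ Y : β → K, ∏ b, G (t (q b)) b (Y b) = 1 := by
    intro t
    rw [← Fintype.prod_sum, ← Fintype.prod_sum]
    simp [hF, hG]
  simp_rw [expand]
  calc _ = ∑ t : I → S, ∑ X : α → K, ∑ Y : β → K, (∏ i, c i (t i)) *
        ((∏ a, F (t (p a)) a (X a)) * ∏ b, G (t (q b)) b (Y b)) := by
        symm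
        rw [Finset.sum_comm]
        exact Finset.sum_congr rfl fun X _ => Finset.sum_comm
    _ = _ := by
        simp_rw [← Finset.mul_sum, ← Finset.sum_mul, marginal, mul_one]
        rw [Fintype.prod_sum]

/-- The distribution of a column of a block: uniform if the half of the column is the
resampled half `m`, and `pick P0 P1 b` otherwise. The halves are `false` for unprimed
and `true` for primed. -/
noncomputable def colDist {k R : ℕ} (P0 P1 : (Fin k → Bool) → ℝ) (b : Bool)
    (m : Option Bool) (c : Fin R ⊕ Fin R) (x : Fin k → Bool) : ℝ :=
  if m = some c.isRight then 1 / 2 ^ k else pick P0 P1 b x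

/-- The position of `j` in the unprimed (`false`) or primed (`true`) half. -/
def half {R : ℕ} : Bool → Fin R → Fin R ⊕ Fin R
  | false => Sum.inl
  | true => Sum.inr

/-- The probability of the bit `s.1` and the resampled half `s.2` within a block. -/
noncomputable def modeWeight (ε : ℝ) (s : Bool × Option Bool) : ℝ :=
  s.2.elim ((1 - 2 * ε) / 2) fun _ => ε / 2

/-- The mass of block `i` conditioned on the bit `s.1` and the resampled half `s.2`. -/
noncomputable def modeMass {U V : Type} {k L R : ℕ} (π : U → V → Fin R → Fin L)
    (P0 P1 : (Fin k → Bool) → ℝ) (u : U) (v w : V) (i : Fin L)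
    (X Y : Fin k → (Fin R ⊕ Fin R) → Bool) (s : Bool × Option Bool) : ℝ :=
  (∏ c with Sum.elim (π u v) (π u v) c = i, colDist P0 P1 s.1 s.2 c fun r => X r c) *
    ∏ c with Sum.elim (π u w) (π u w) c = i, colDist P0 P1 (!s.1) s.2 c fun r => Y r c

theorem sum_colDist {k R : ℕ} {P0 P1 : (Fin k → Bool) → ℝ}
    (hP0s : ∑ x, P0 x = 1) (hP1s : ∑ x, P1 x = 1) (b : Bool) (m : Option Bool)
    (c : Fin R ⊕ Fin R) : ∑ x, colDist P0 P1 b m c x = 1 := by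
  unfold colDist pick
  split_ifs <;> simp [hP0s, hP1s]

theorem colDist_nonneg {k R : ℕ} {P0 P1 : (Fin k → Bool) → ℝ}
    (hP0 : ∀ x, 0 ≤ P0 x) (hP1 : ∀ x, 0 ≤ P1 x) (b : Bool) (m : Option Bool)
    (c : Fin R ⊕ Fin R) (x : Fin k → Bool) : 0 ≤ colDist P0 P1 b m c x := by
  unfold colDist pick
  split_ifs
  · positivity
  · exact hP1 x
  · exact hP0 x

theorem prod_sumElim_fiber {L R : ℕ} (p : Fin R → Fin L) (i : Fin L)
    (f : Fin R ⊕ Fin R → ℝ) :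
    ∏ c with Sum.elim p p c = i, f c =
      ∏ j with p j = i, f (Sum.inl j) * f (Sum.inr j) := by
  rw [Finset.prod_mul_distrib, Finset.prod_filter, Fintype.prod_sum_type,
    Finset.prod_filter, Finset.prod_filter]
  rfl

section Block

variable {U V : Type} {k L R : ℕ} {π : U → V → Fin R → Fin L}
  {P0 P1 : (Fin k → Bool) → ℝ} {u : U} {v w : V}

theorem modeMass_nonneg (hP0 : ∀ x, 0 ≤ P0 x) (hP1 : ∀ x, 0 ≤ P1 x) (i : Fin L)
    (X Y : Fin k → (Fin R ⊕ Fin R) → Bool) (s : Bool × Option Bool) :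
    0 ≤ modeMass π P0 P1 u v w i X Y s :=
  mul_nonneg (Finset.prod_nonneg fun _ _ => colDist_nonneg hP0 hP1 _ _ _ _)
    (Finset.prod_nonneg fun _ _ => colDist_nonneg hP0 hP1 _ _ _ _)

theorem blockM_eq_sum_modeMass {d : ℕ} {ε : ℝ} {i : Fin L}
    (hv : (fib π u v i).card = d) (hw : (fib π u w i).card = d)
    (X Y : Fin k → (Fin R ⊕ Fin R) → Bool) :
    blockM π ε P0 P1 d u v w i X Y =
      ∑ s, modeWeight ε s * modeMass π P0 P1 u v w i X Y s := by
  unfold fib at hv hw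
  simp only [blockM, modeMass, prod_sumElim_fiber, Fintype.sum_prod_type,
    Fintype.sum_option, Fintype.sum_bool, fib, modeWeight, colDist, Finset.prod_mul_distrib,
    Option.elim, Sum.isRight_inl, Sum.isRight_inr, reduceCtorEq, Option.some.injEq,
    if_true, if_false, Finset.prod_const, hv, hw]
  ring

theorem sum_prod_modeMass (hP0s : ∑ x, P0 x = 1) (hP1s : ∑ x, P1 x = 1)
    (c : Fin L → Bool × Option Bool → ℝ) :
    ∑ X, ∑ Y, ∏ i, ∑ s, c i s * modeMass π P0 P1 u v w i X Y s = ∏ i, ∑ s, c i s := by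
  rw [← sum_prod_mixture (Sum.elim (π u v) (π u v)) (Sum.elim (π u w) (π u w))
    (fun s => colDist P0 P1 s.1 s.2) (fun s => colDist P0 P1 (!s.1) s.2)
    (fun s => sum_colDist hP0s hP1s s.1 s.2) (fun s => sum_colDist hP0s hP1s (!s.1) s.2) c]
  refine Fintype.sum_equiv (Equiv.piComm _) _ _ fun X => ?_
  exact Fintype.sum_equiv (Equiv.piComm _) _ _ fun Y => rfl

theorem covered_of_modeMass_ne_zero {P : ((Fin k → Bool) × (Fin k → Bool)) → Prop}
    (hP : ∀ a b : Fin k → Bool, P0 a ≠ 0 → P1 b ≠ 0 → P (a, b) ∧ P (b, a))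
    {i : Fin L} {j j' : Fin R} (hj : π u v j = i) (hj' : π u w j' = i)
    {X Y : Fin k → (Fin R ⊕ Fin R) → Bool} {s : Bool × Option Bool} {h : Bool}
    (hs : s.2 ≠ some h) (hne : modeMass π P0 P1 u v w i X Y s ≠ 0) :
    P (fun r => X r (half h j), fun r => Y r (half h j')) := by
  have hX := Finset.prod_ne_zero_iff.1 (left_ne_zero_of_mul hne) (half h j)
    (by cases h <;> simpa [half] using hj)
  have hY := Finset.prod_ne_zero_iff.1 (right_ne_zero_of_mul hne) (half h j')
    (by cases h <;> simpa [half] using hj')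
  have hr : ∀ l : Fin R, (half h l).isRight = h := by cases h <;> simp [half]
  obtain ⟨b, m⟩ := s
  simp only [colDist, hr, if_neg hs] at hX hY
  cases b
  · exact (hP _ _ hX hY).1
  · exact (hP _ _ hY hX).2

theorem modeWeight_nonneg {ε : ℝ} (hε1 : 0 ≤ ε) (hε2 : ε ≤ 1 / 2)
    (s : Bool × Option Bool) : 0 ≤ modeWeight ε s := by
  rcases s with ⟨b, _ | m⟩ <;> simp only [modeWeight, Option.elim] <;> linarith

theorem sum_modeWeight (ε : ℝ) : ∑ s, modeWeight ε s = 1 := by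
  simp [Fintype.sum_prod_type, Fintype.sum_option, modeWeight]
  ring

theorem sum_modeWeight_of_ne (ε : ℝ) (h : Bool) :
    ∑ s : Bool × Option Bool, (if s.2 = some h then 0 else modeWeight ε s) = 1 - ε := by
  cases h <;> simp [Fintype.sum_prod_type, Fintype.sum_option, modeWeight] <;> ring

theorem one_sub_le_ET2 {d : ℕ} {ε : ℝ} (hε1 : 0 ≤ ε) (hε2 : ε ≤ 1 / 2)
    (hfib : ∀ (u : U) (v : V) (i : Fin L), (fib π u v i).card = d)
    (hP0 : ∀ x, 0 ≤ P0 x) (hP1 : ∀ x, 0 ≤ P1 x)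
    (hP0s : ∑ x, P0 x = 1) (hP1s : ∑ x, P1 x = 1)
    {P : ((Fin k → Bool) × (Fin k → Bool)) → Prop} [DecidablePred P]
    (hP : ∀ a b : Fin k → Bool, P0 a ≠ 0 → P1 b ≠ 0 → P (a, b) ∧ P (b, a))
    {i₀ : Fin L} {j j' : Fin R} (hj : π u v j = i₀) (hj' : π u w j' = i₀) (h : Bool) :
    1 - ε ≤ ET2 π ε P0 P1 d u v w (fun X Y =>
      if P (fun r => X r (half h j), fun r => Y r (half h j')) then 1 else 0) := by
  let c : Fin L → Bool × Option Bool → ℝ := fun i s =>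
    if i = i₀ ∧ s.2 = some h then 0 else modeWeight ε s
  have hc0 : ∀ i s, 0 ≤ c i s := fun i s => by
    simp only [c]; split_ifs; exacts [le_rfl, modeWeight_nonneg hε1 hε2 s]
  have hcle : ∀ i s, c i s ≤ modeWeight ε s := fun i s => by
    simp only [c]; split_ifs; exacts [modeWeight_nonneg hε1 hε2 s, le_rfl]
  have htotal : ∏ i, ∑ s, c i s = 1 - ε := by
    rw [Finset.prod_eq_single i₀ (fun i _ hi => ?_) (by simp)]
    · simpa [c] using sum_modeWeight_of_ne ε h
    · simpa [c, hi] using sum_modeWeight ε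
  rw [← htotal, ← sum_prod_modeMass (π := π) (u := u) (v := v) (w := w) hP0s hP1s, ET2]
  refine Finset.sum_le_sum fun X _ => Finset.sum_le_sum fun Y _ => ?_
  simp only [massT2, blockM_eq_sum_modeMass (hfib u v _) (hfib u w _)]
  have hm := modeMass_nonneg (π := π) (u := u) (v := v) (w := w) hP0 hP1
  split_ifs with hcov
  · rw [mul_one]
    exact Finset.prod_le_prod
      (fun i _ => Finset.sum_nonneg fun s _ => mul_nonneg (hc0 i s) (hm i X Y s))
      fun i _ => Finset.sum_le_sum fun s _ => mul_le_mul_of_nonneg_right (hcle i s) (hm i X Y s)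
  · rw [mul_zero]
    refine (Finset.prod_eq_zero (Finset.mem_univ i₀) (Finset.sum_eq_zero fun s _ => ?_)).le
    by_cases hs : s.2 = some h
    · simp [c, hs]
    · rw [not_ne_iff.1 (mt (covered_of_modeMass_ne_zero hP hj hj' hs) hcov), mul_zero]

end Block

theorem le_Euvw {U V : Type} [Fintype U] [Fintype V] [Nonempty U] {Adj : U → V → Bool}
    (hpos : ∀ u, 0 < (nbr Adj u).card) {a : ℝ} {h : U → V → V → ℝ}
    (ha : ∀ u v w, Adj u v = true → Adj u w = true → a ≤ h u v w) : a ≤ Euvw Adj h := by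
  have hu : ∀ u, a ≤ (1 / ((nbr Adj u).card : ℝ) ^ 2) *
      ∑ v ∈ nbr Adj u, ∑ w ∈ nbr Adj u, h u v w := by
    intro u
    have hcard : (0 : ℝ) < (nbr Adj u).card := Nat.cast_pos.2 (hpos u)
    rw [one_div_mul_eq_div, le_div_iff₀ (by positivity)]
    calc a * ((nbr Adj u).card : ℝ) ^ 2 = ∑ v ∈ nbr Adj u, ∑ w ∈ nbr Adj u, a := by
          simp only [Finset.sum_const, nsmul_eq_mul]; ring
      _ ≤ _ := Finset.sum_le_sum fun v hv => Finset.sum_le_sum fun w hw =>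
          ha u v w (Finset.mem_filter.1 hv).2 (Finset.mem_filter.1 hw).2
  have hcard : (0 : ℝ) < Fintype.card U := Nat.cast_pos.2 Fintype.card_pos
  rw [Euvw, one_div_mul_eq_div, le_div_iff₀ hcard]
  calc a * Fintype.card U = ∑ _u : U, a := by simp [mul_comm]
    _ ≤ _ := Finset.sum_le_sum fun u _ => hu u

/-- completeness of `𝒯₂`: let `P ⊆ {0,1}^{2k}` (viewed as pairs of
`k`-tuples) contain `a·b` and `b·a` for every `a ∈ supp 𝒫₀` and `b ∈ supp 𝒫₁`.  If the
Label-Cover instance has a labeling satisfying all edges, then the assignments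
`f_v(x) := x_{ℓ(v)}` and `g_v(x) := x_{R+ℓ(v)}` each cover at least a `1 − ε` fraction of
the constraints of the `P`-CSP instance `𝒢` produced by `𝒯₂`, and every constraint in the
support of `𝒯₂` is covered by `f` or by `g`; hence `{f, g}` is a `2`-covering of `𝒢`. -/
theorem stmt_15 (k L R d : ℕ) (hk : 2 ≤ k) (hd : 0 < d) (hR : R = d * L)
    {U V : Type} [Fintype U] [Fintype V] [Nonempty U] [Nonempty V]
    (Adj : U → V → Bool) (π : U → V → Fin R → Fin L)
    (dU dV : ℕ) (hdU : 0 < dU) (hdV : 0 < dV)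
    (hregU : ∀ u : U, (nbr Adj u).card = dU)
    (hregV : ∀ v : V, (univ.filter (fun u : U => Adj u v = true)).card = dV)
    (hfib : ∀ (u : U) (v : V) (i : Fin L), (fib π u v i).card = d)
    (ε : ℝ) (hε1 : 0 < ε) (hε2 : ε ≤ 1 / 2)
    (P0 P1 : (Fin k → Bool) → ℝ)
    (hP0 : ∀ x, 0 ≤ P0 x) (hP1 : ∀ x, 0 ≤ P1 x)
    (hP0s : ∑ x, P0 x = 1) (hP1s : ∑ x, P1 x = 1)
    (hP0m : ∀ (j : Fin k) (b : Bool),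
      ∑ x ∈ univ.filter (fun x : Fin k → Bool => x j = b), P0 x = 1 / 2)
    (hP1m : ∀ (j : Fin k) (b : Bool),
      ∑ x ∈ univ.filter (fun x : Fin k → Bool => x j = b), P1 x = 1 / 2)
    (hP0p : ∀ x : Fin k → Bool, P0 x ≠ 0 → Even (univ.filter (fun i => x i = true)).card)
    (hP1p : ∀ x : Fin k → Bool, P1 x ≠ 0 → Odd (univ.filter (fun i => x i = true)).card)
    (P : ((Fin k → Bool) × (Fin k → Bool)) → Prop) [DecidablePred P]
    (hP : ∀ a b : Fin k → Bool, P0 a ≠ 0 → P1 b ≠ 0 → P (a, b) ∧ P (b, a))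
    (ℓU : U → Fin L) (ℓV : V → Fin R)
    (hlab : ∀ (u : U) (v : V), Adj u v = true → π u v (ℓV v) = ℓU u) :
    (1 - ε ≤ Euvw Adj (fun u v w => ET2 π ε P0 P1 d u v w
        (fun X Y => if P (fun j => X j (Sum.inl (ℓV v)), fun j => Y j (Sum.inl (ℓV w)))
          then 1 else 0)))
    ∧ (1 - ε ≤ Euvw Adj (fun u v w => ET2 π ε P0 P1 d u v w
        (fun X Y => if P (fun j => X j (Sum.inr (ℓV v)), fun j => Y j (Sum.inr (ℓV w)))
          then 1 else 0)))
    ∧ (∀ (u : U) (v w : V) (X Y : Fin k → (Fin R ⊕ Fin R) → Bool),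
        Adj u v = true → Adj u w = true → 0 < massT2 π ε P0 P1 d u v w X Y →
        P (fun j => X j (Sum.inl (ℓV v)), fun j => Y j (Sum.inl (ℓV w))) ∨
        P (fun j => X j (Sum.inr (ℓV v)), fun j => Y j (Sum.inr (ℓV w)))) := by
  have hpos : ∀ u, 0 < (nbr Adj u).card := fun u => hregU u ▸ hdU
  have hcover : ∀ h : Bool, 1 - ε ≤ Euvw Adj (fun u v w => ET2 π ε P0 P1 d u v w (fun X Y =>
      if P (fun j => X j (half h (ℓV v)), fun j => Y j (half h (ℓV w))) then 1 else 0)) :=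
    fun h => le_Euvw hpos fun u v w hv hw =>
      one_sub_le_ET2 hε1.le hε2 hfib hP0 hP1 hP0s hP1s hP (hlab u v hv) (hlab u w hw) h
  refine ⟨hcover false, hcover true, fun u v w X Y hv hw hmass => ?_⟩
  have hblock := Finset.prod_ne_zero_iff.1 hmass.ne' (ℓU u) (Finset.mem_univ _)
  rw [blockM_eq_sum_modeMass (hfib u v _) (hfib u w _)] at hblock
  obtain ⟨s, -, hs⟩ := Finset.exists_ne_zero_of_sum_ne_zero hblock
  have hcov : ∀ h : Bool, s.2 ≠ some h →
      P (fun j => X j (half h (ℓV v)), fun j => Y j (half h (ℓV w))) := fun h hsh =>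
    covered_of_modeMass_ne_zero hP (hlab u v hv) (hlab u w hw) hsh (right_ne_zero_of_mul hs)
  by_cases hsf : s.2 = some false
  · exact Or.inr (hcov true (by simp [hsf]))
  · exact Or.inl (hcov false hsf)
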